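/- arXiv:1809.08299 — 2 statements merged into one kernel-verified Lean document; each statement's English description precedes it below -/
import Mathlib

section
/- Cantor's back-and-forth theorem for relevant DLO: let M=⟨W,R,D,*,s,V⟩ and N=⟨W',R',D',*',s',V'⟩ be B-models over the signature of DLO, both satisfying the K condition and seriality, both with countable domains, whose designated worlds satisfy all axioms of DLO. Let a₁,…,aₙ ∈ D and b₁,…,bₙ ∈ D' be such that a₁ < … < aₙ holds at s in M and b₁ < … < bₙ holds at s' in N. Then there is a bijection f : D → D' with f(aᵢ)=bᵢ for each i, such that for every formula A and every assignment ā of elements of D: M,s ⊨ A[ā] if and only if N,s' ⊨ A[f(ā)]. -/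
namespace RM

/-- A first-order signature: function symbols with arities and
relation symbols with arities. -/
structure Signature where
  Func : Type
  farity : Func → ℕ
  Rel : Type
  rarity : Rel → ℕ

variable {σ : Signature}

/-- Terms over a signature, with variables indexed by `ℕ`. -/
inductive Term (σ : Signature) : Type where
  | var : ℕ → Term σ
  | func : (f : σ.Func) → (Fin (σ.farity f) → Term σ) → Term σ

/-- Formulas of the quantificational relevant language:
`⊥`, `⊤`, (logical) equality, atomic relations, `∧`, `∨`, `¬`, `→`, `∀`, `∃`. -/
inductive Formula (σ : Signature) : Type where
  | falsum : Formula σ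
  | verum : Formula σ
  | equal : Term σ → Term σ → Formula σ
  | rel : (r : σ.Rel) → (Fin (σ.rarity r) → Term σ) → Formula σ
  | and : Formula σ → Formula σ → Formula σ
  | or : Formula σ → Formula σ → Formula σ
  | neg : Formula σ → Formula σ
  | imp : Formula σ → Formula σ → Formula σ
  | all : ℕ → Formula σ → Formula σ
  | ex : ℕ → Formula σ → Formula σ

/-- The relevant biconditional `A ↔ B := (A → B) ∧ (B → A)`. -/
def Formula.iff (A B : Formula σ) : Formula σ := .and (.imp A B) (.imp B A)

/-- Free variables of a term. -/
def Term.fv : Term σ → Set ℕ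
  | .var n => {n}
  | .func _ ts => ⋃ i, (ts i).fv

/-- Free variables of a formula. -/
def Formula.fv : Formula σ → Set ℕ
  | .falsum => ∅
  | .verum => ∅
  | .equal t u => t.fv ∪ u.fv
  | .rel _ ts => ⋃ i, (ts i).fv
  | .and A B => A.fv ∪ B.fv
  | .or A B => A.fv ∪ B.fv
  | .imp A B => A.fv ∪ B.fv
  | .neg A => A.fv
  | .all x A => A.fv \ {x}
  | .ex x A => A.fv \ {x}

/-- Quantifier-free formulas. -/
def Formula.QFree : Formula σ → Prop
  | .falsum => True
  | .verum => True
  | .equal _ _ => True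
  | .rel _ _ => True
  | .and A B => A.QFree ∧ B.QFree
  | .or A B => A.QFree ∧ B.QFree
  | .imp A B => A.QFree ∧ B.QFree
  | .neg A => A.QFree
  | .all _ _ => False
  | .ex _ _ => False

/-- A sentence is a formula with no free variables. -/
def Formula.Sentence (A : Formula σ) : Prop := A.fv = ∅

/-- A `B`-model (Routley–Meyer model for the basic relevant logic **B**):
worlds `W`, ternary relation `R`, domain `D`, Routley star `*`,
designated world `s`, world-independent interpretation of function symbols,
world-relative valuation `V` of relation symbols, subject to the usual
conditions; the logical equality symbol is always interpreted as real identity. -/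
structure BModel (σ : Signature) where
  W : Type
  R : W → W → W → Prop
  D : Type
  dne : Nonempty D
  star : W → W
  s : W
  interpFunc : (f : σ.Func) → (Fin (σ.farity f) → D) → D
  V : W → (r : σ.Rel) → (Fin (σ.rarity r) → D) → Prop
  base : ∀ α, R s α α
  btrans : ∀ α β γ δ, R s α β → R β γ δ → R α γ δ
  star_star : ∀ α, star (star α) = α
  star_anti : ∀ α β, R s α β → R s (star β) (star α)
  hered : ∀ α β, R s α β → ∀ r v, V α r v → V β r v

namespace BModel

variable (M : BModel σ)

/-- Evaluation of a term under an assignment. -/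
def evalT (a : ℕ → M.D) : Term σ → M.D
  | .var n => a n
  | .func f ts => M.interpFunc f fun i => evalT a (ts i)

/-- Truth of a formula at a world, under an assignment of domain
elements to variables (Routley–Meyer truth conditions). -/
def Truth : M.W → (ℕ → M.D) → Formula σ → Prop
  | _, _, .falsum => False
  | _, _, .verum => True
  | _, a, .equal t u => M.evalT a t = M.evalT a u
  | w, a, .rel r ts => M.V w r fun i => M.evalT a (ts i)
  | w, a, .and A B => Truth w a A ∧ Truth w a B
  | w, a, .or A B => Truth w a A ∨ Truth w a B
  | w, a, .neg A => ¬ Truth (M.star w) a A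
  | w, a, .imp A B => ∀ w₁ w₂, M.R w w₁ w₂ → Truth w₁ a A → Truth w₂ a B
  | w, a, .all x A => ∀ d : M.D, Truth w (Function.update a x d) A
  | w, a, .ex x A => ∃ d : M.D, Truth w (Function.update a x d) A

/-- `M` satisfies `A` (at the designated world, under every assignment). -/
def SatAx (A : Formula σ) : Prop := ∀ a : ℕ → M.D, M.Truth M.s a A

/-- `M` satisfies the theory `T` at its designated world. -/
def SatTheory (T : Set (Formula σ)) : Prop := ∀ A ∈ T, M.SatAx A

/-- Seriality: every world sees some pair via `R`. -/
def Serial : Prop := ∀ x : M.W, ∃ y z, M.R x y z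

/-- The frame condition corresponding to the axiom `K`: `Rαβγ → Rsαγ`. -/
def Kcond : Prop := ∀ α β γ, M.R α β γ → M.R M.s α γ

/-- The additional frame conditions making a `B`-model an `RM`-model. -/
def IsRM : Prop :=
  (∀ α β γ, M.R α β γ → M.R α (M.star γ) (M.star β)) ∧
  (∀ α β γ, M.R α β γ → M.R α γ β) ∧
  (∀ α, M.R α α α) ∧
  (∀ α β γ δ, (∃ x, M.R α β x ∧ M.R x γ δ) → ∃ y, M.R α y δ ∧ M.R β γ y) ∧
  (∀ α β γ, M.R α β γ → M.R M.s α γ ∨ M.R M.s β γ)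

end BModel

/-- Semantic entailment over a class `C` of `B`-models: every model in `C`
whose designated world satisfies all of `T` also satisfies `A` at its
designated world. -/
def Entails (C : BModel σ → Prop) (T : Set (Formula σ)) (A : Formula σ) : Prop :=
  ∀ M : BModel σ, C M → M.SatTheory T → M.SatAx A

end RM


open RM

/-- The signature of DLO: no function symbols, one binary relation `<`. -/
def dloSig : Signature := ⟨Empty, fun e => e.elim, Unit, fun _ => 2⟩

namespace DLO

/-- Variable `n` as a term of the language of DLO. -/
def v (n : ℕ) : Term dloSig := .var n

/-- The atomic formula `t < u`. -/
def lt (t u : Term dloSig) : Formula dloSig := .rel () ![t, u]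

/-- A1: `∀x(x<x → ⊥)`. -/
def ax1 : Formula dloSig := .all 0 (.imp (lt (v 0) (v 0)) .falsum)
/-- A2: `∀x,y(x=y ∨ x<y ∨ y<x)`. -/
def ax2 : Formula dloSig :=
  .all 0 (.all 1 (.or (.equal (v 0) (v 1)) (.or (lt (v 0) (v 1)) (lt (v 1) (v 0)))))
/-- A3: `∀x,y,z((x<y ∧ y<z) → x<z)`. -/
def ax3 : Formula dloSig :=
  .all 0 (.all 1 (.all 2 (.imp (.and (lt (v 0) (v 1)) (lt (v 1) (v 2))) (lt (v 0) (v 2)))))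
/-- A4: `∀x,y(x<y → ∃z(x<z ∧ z<y))`. -/
def ax4 : Formula dloSig :=
  .all 0 (.all 1 (.imp (lt (v 0) (v 1)) (.ex 2 (.and (lt (v 0) (v 2)) (lt (v 2) (v 1))))))
/-- A5: `∀x∃y(x<y)`. -/
def ax5 : Formula dloSig := .all 0 (.ex 1 (lt (v 0) (v 1)))
/-- A6: `∀x∃y(y<x)`. -/
def ax6 : Formula dloSig := .all 0 (.ex 1 (lt (v 1) (v 0)))

/-- The theory DLO of dense linear orders without endpoints. -/
def theory : Set (Formula dloSig) := {ax1, ax2, ax3, ax4, ax5, ax6}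

end DLO


namespace Order.PartialIso

/-- Any finite partial isomorphism between countable dense linear orders without endpoints extends
to an order isomorphism. -/
theorem exists_orderIso_extending {α β : Type*} [LinearOrder α] [LinearOrder β]
    [Countable α] [DenselyOrdered α] [NoMinOrder α] [NoMaxOrder α] [Nonempty α]
    [Countable β] [DenselyOrdered β] [NoMinOrder β] [NoMaxOrder β] [Nonempty β]
    (p : PartialIso α β) : ∃ e : α ≃o β, ∀ q ∈ p.val, e q.1 = q.2 := by
  cases nonempty_encodable α
  cases nonempty_encodable β
  let 𝒟 : α ⊕ β → Cofinal (PartialIso α β) :=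
    Sum.elim (definedAtLeft β) (definedAtRight α)
  let I : Ideal (PartialIso α β) := idealOfCofinals p 𝒟
  have hI {f g : PartialIso α β} (hf : f ∈ I) (hg : g ∈ I) {q r : α × β} (hq : q ∈ f.val)
      (hr : r ∈ g.val) : cmp q.1 r.1 = cmp q.2 r.2 := by
    obtain ⟨m, -, hfm, hgm⟩ := I.directed _ hf _ hg
    exact m.prop q (hfm hq) r (hgm hr)
  let F a := funOfIdeal a I (cofinal_meets_idealOfCofinals _ 𝒟 (Sum.inl a))
  let G b := invOfIdeal b I (cofinal_meets_idealOfCofinals _ 𝒟 (Sum.inr b))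
  refine ⟨OrderIso.ofCmpEqCmp (fun a ↦ (F a).val) (fun b ↦ (G b).val) fun a b ↦ ?_,
    fun q hq ↦ ?_⟩
  · obtain ⟨f, hf, ha⟩ := (F a).prop
    obtain ⟨g, hg, hb⟩ := (G b).prop
    exact hI hf hg ha hb
  · obtain ⟨f, hf, ha⟩ := (F q.1).prop
    exact (cmp_eq_eq_iff _ _).1 ((hI hf (mem_idealOfCofinals p 𝒟) ha hq).symm.trans
      (cmp_self_eq_eq _))

end Order.PartialIso

/-- Strictly increasing finite sequences of equal length in countable dense linear orders without
endpoints are matched by an order isomorphism. -/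
theorem exists_orderIso_apply_eq_of_strictMono {ι α β : Type*} [LinearOrder ι] [Finite ι]
    [LinearOrder α] [LinearOrder β]
    [Countable α] [DenselyOrdered α] [NoMinOrder α] [NoMaxOrder α] [Nonempty α]
    [Countable β] [DenselyOrdered β] [NoMinOrder β] [NoMaxOrder β] [Nonempty β]
    {a : ι → α} {b : ι → β} (ha : StrictMono a) (hb : StrictMono b) :
    ∃ e : α ≃o β, ∀ i, e (a i) = b i := by
  classical
  cases nonempty_fintype ι
  let p : Order.PartialIso α β := ⟨Finset.univ.image fun i ↦ (a i, b i), by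
    simp only [Finset.mem_image, Finset.mem_univ, true_and]
    rintro _ ⟨i, rfl⟩ _ ⟨j, rfl⟩
    exact (ha.cmp_map_eq i j).trans (hb.cmp_map_eq i j).symm⟩
  obtain ⟨e, he⟩ := p.exists_orderIso_extending
  exact ⟨e, fun i ↦ he (a i, b i) (Finset.mem_image_of_mem _ (Finset.mem_univ i))⟩

namespace RM.BModel

/-- Under the K condition, the designated world is below every world. -/
theorem Kcond.rel_designated {σ : Signature} {M : BModel σ} (hK : M.Kcond) (w : M.W) :
    M.R M.s M.s w :=
  hK _ _ _ (M.base w)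

/-- In serial models, a bijection of domains that preserves `<` between all pairs of worlds
preserves the truth of all formulas between all pairs of worlds. -/
theorem truth_iff_of_equiv {M N : BModel dloSig} (hM : M.Serial) (hN : N.Serial) (f : M.D ≃ N.D)
    (hf : ∀ w w' x y, M.V w () ![x, y] ↔ N.V w' () ![f x, f y]) (A : Formula dloSig)
    (w : M.W) (w' : N.W) (c : ℕ → M.D) :
    M.Truth w c A ↔ N.Truth w' (fun k ↦ f (c k)) A := by
  have evalT_map (c : ℕ → M.D) (t : Term dloSig) :
      N.evalT (fun k ↦ f (c k)) t = f (M.evalT c t) := by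
    cases t with
    | var n => rfl
    | func e ts => exact e.elim
  have update_map (c : ℕ → M.D) (x : ℕ) (d : M.D) :
      (fun k ↦ f (Function.update c x d k)) = Function.update (fun k ↦ f (c k)) x (f d) :=
    (Function.comp_update f c x d)
  induction A generalizing w w' c with
  | falsum => rfl
  | verum => rfl
  | equal t u => simp only [Truth, evalT_map, f.apply_eq_iff_eq]
  | rel r ts =>
    have vec_eq {D : Type} (u : Fin 2 → D) : u = ![u 0, u 1] := by
      ext i; fin_cases i <;> rfl
    simp only [Truth, evalT_map]
    exact (iff_of_eq (congrArg (M.V w ()) (vec_eq fun i : Fin 2 ↦ M.evalT c (ts i)))).trans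
      ((hf w w' _ _).trans
        (iff_of_eq (congrArg (N.V w' ()) (vec_eq fun i : Fin 2 ↦ f (M.evalT c (ts i))))).symm)
  | and A B ihA ihB => exact and_congr (ihA w w' c) (ihB w w' c)
  | or A B ihA ihB => exact or_congr (ihA w w' c) (ihB w w' c)
  | neg A ih => exact not_congr (ih _ _ c)
  | imp A B ihA ihB =>
    constructor
    · intro h y z _ hA
      obtain ⟨u, v, huv⟩ := hM w
      exact (ihB v z c).1 (h u v huv ((ihA u y c).2 hA))
    · intro h y z _ hA
      obtain ⟨u, v, huv⟩ := hN w'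
      exact (ihB z v c).2 (h u v huv ((ihA y u c).1 hA))
  | all x A ih =>
    refine f.forall_congr fun {d} ↦ ?_
    rw [← update_map]
    exact ih _ _ _
  | ex x A ih =>
    refine f.exists_congr fun d ↦ ?_
    rw [← update_map]
    exact ih _ _ _

end RM.BModel

namespace DLO

variable {M : BModel dloSig}

theorem truth_lt (w : M.W) (c : ℕ → M.D) (i j : ℕ) :
    M.Truth w c (lt (v i) (v j)) ↔ M.V w () ![c i, c j] := by
  have h : (fun k : Fin 2 ↦ M.evalT c (![v i, v j] k)) = ![c i, c j] := by
    ext k; fin_cases k <;> rfl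
  exact iff_of_eq (congrArg (M.V w ()) h)

theorem not_lt_self (hT : M.SatTheory theory) (w : M.W) (x : M.D) : ¬ M.V w () ![x, x] := by
  have h := hT ax1 (by simp [theory]) (fun _ ↦ x) x w w (M.base w)
  simpa [truth_lt, BModel.Truth] using h

theorem eq_or_lt_or_lt (hT : M.SatTheory theory) (x y : M.D) :
    x = y ∨ M.V M.s () ![x, y] ∨ M.V M.s () ![y, x] := by
  have h := hT ax2 (by simp [theory]) (fun _ ↦ x) x y
  simp only [truth_lt, BModel.Truth] at h
  exact h

theorem lt_trans (hT : M.SatTheory theory) {w : M.W} {x y z : M.D}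
    (hxy : M.V w () ![x, y]) (hyz : M.V w () ![y, z]) : M.V w () ![x, z] := by
  have h := hT ax3 (by simp [theory]) (fun _ ↦ x) x y z w w (M.base w)
  simp only [truth_lt, BModel.Truth] at h
  exact h ⟨hxy, hyz⟩

theorem exists_between (hT : M.SatTheory theory) {w : M.W} {x y : M.D}
    (hxy : M.V w () ![x, y]) : ∃ z, M.V w () ![x, z] ∧ M.V w () ![z, y] := by
  have h := hT ax4 (by simp [theory]) (fun _ ↦ x) x y w w (M.base w)
  simp only [truth_lt, BModel.Truth] at h
  exact h hxy

theorem exists_gt (hT : M.SatTheory theory) (x : M.D) : ∃ y, M.V M.s () ![x, y] := by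
  have h := hT ax5 (by simp [theory]) (fun _ ↦ x) x
  simp only [truth_lt, BModel.Truth] at h
  exact h

theorem exists_lt (hT : M.SatTheory theory) (x : M.D) : ∃ y, M.V M.s () ![y, x] := by
  have h := hT ax6 (by simp [theory]) (fun _ ↦ x) x
  simp only [truth_lt, BModel.Truth] at h
  exact h

/-- In models of DLO satisfying the K condition, every world interprets `<` in the same way. -/
theorem lt_iff_lt_designated (hK : M.Kcond) (hT : M.SatTheory theory) (w : M.W) (x y : M.D) :
    M.V w () ![x, y] ↔ M.V M.s () ![x, y] := by
  refine ⟨fun h ↦ ?_, M.hered _ _ (hK.rel_designated w) _ _⟩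
  rcases eq_or_lt_or_lt hT x y with rfl | hxy | hyx
  · exact (not_lt_self hT w x h).elim
  · exact hxy
  · exact (not_lt_self hT w x
      (lt_trans hT h (M.hered _ _ (hK.rel_designated w) _ _ hyx))).elim

/-- The linear order on the domain of a model of DLO given by `<` at the designated world. -/
noncomputable abbrev linearOrder (hT : M.SatTheory theory) : LinearOrder M.D :=
  @linearOrderOfSTO M.D (fun x y ↦ M.V M.s () ![x, y])
    { irrefl := not_lt_self hT M.s
      trans := fun _ _ _ ↦ lt_trans hT
      trichotomous := fun x y hxy hyx ↦
        (eq_or_lt_or_lt hT x y).resolve_right (not_or.2 ⟨hxy, hyx⟩) }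
    (Classical.decRel _)

theorem denselyOrdered (hT : M.SatTheory theory) :
    letI := linearOrder hT; DenselyOrdered M.D :=
  letI := linearOrder hT; ⟨fun _ _ ↦ exists_between hT⟩

theorem noMaxOrder (hT : M.SatTheory theory) :
    letI := linearOrder hT; NoMaxOrder M.D :=
  letI := linearOrder hT; ⟨exists_gt hT⟩

theorem noMinOrder (hT : M.SatTheory theory) :
    letI := linearOrder hT; NoMinOrder M.D :=
  letI := linearOrder hT; ⟨exists_lt hT⟩

end DLO

/-- **Cantor's back-and-forth theorem for relevant DLO**: between any two
countable models of DLO over **B** + `K` with serial frames, and any two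
matching finite increasing sequences, there is a bijection of the domains
extending the matching and preserving the truth of all formulas at the
designated worlds. -/
theorem stmt_13 (M N : BModel dloSig)
    (hKM : M.Kcond) (hSM : M.Serial) (hKN : N.Kcond) (hSN : N.Serial)
    (hcM : Countable M.D) (hcN : Countable N.D)
    (hTM : M.SatTheory DLO.theory) (hTN : N.SatTheory DLO.theory)
    (n : ℕ) (a : Fin n → M.D) (b : Fin n → N.D)
    (ha : ∀ i j : Fin n, i < j → M.V M.s () ![a i, a j])
    (hb : ∀ i j : Fin n, i < j → N.V N.s () ![b i, b j]) :
    ∃ f : M.D ≃ N.D, (∀ i, f (a i) = b i) ∧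
      ∀ (A : Formula dloSig) (asg : ℕ → M.D),
        M.Truth M.s asg A ↔ N.Truth N.s (fun k => f (asg k)) A := by
  let := DLO.linearOrder hTM
  let := DLO.linearOrder hTN
  have := M.dne
  have := N.dne
  have := DLO.denselyOrdered hTM
  have := DLO.denselyOrdered hTN
  have := DLO.noMaxOrder hTM
  have := DLO.noMaxOrder hTN
  have := DLO.noMinOrder hTM
  have := DLO.noMinOrder hTN
  obtain ⟨e, he⟩ := exists_orderIso_apply_eq_of_strictMono (a := a) (b := b)
    (fun _ _ h ↦ ha _ _ h) (fun _ _ h ↦ hb _ _ h)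
  refine ⟨e.toEquiv, he, fun A c ↦
    BModel.truth_iff_of_equiv hSM hSN e.toEquiv (fun w w' x y ↦ ?_) A _ _ c⟩
  rw [DLO.lt_iff_lt_designated hKM hTM, DLO.lt_iff_lt_designated hKN hTN]
  exact (e.lt_iff_lt (x := x) (y := y)).symm
end

section
/- Completeness of DLO over B + K with seriality: let M and N be any two B-models over the signature of DLO, each satisfying the K condition and seriality, whose designated worlds satisfy all axioms of DLO. Then for every sentence A of the language of DLO: M,s ⊨ A if and only if N,s' ⊨ A. That is, any two such models of DLO satisfy exactly the same sentences at their designated worlds. -/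
open RM

namespace RM

namespace BModel

/-- Under the K condition the designated world is below every world. -/
theorem Kcond.base_le {σ : Signature} {M : BModel σ} (h : M.Kcond) (w : M.W) : M.R M.s M.s w :=
  h M.s w w (M.base w)

/-- `M` interprets the symbol of the language of DLO at every world by the
same dense linear order without endpoints on its domain. -/
structure IsRigidDLO (M : BModel dloSig) [LinearOrder M.D] : Prop where
  val_iff : ∀ w x, M.V w () x ↔ x (0 : Fin 2) < x (1 : Fin 2)
  dense : DenselyOrdered M.D
  noMin : NoMinOrder M.D
  noMax : NoMaxOrder M.D

variable {M : BModel dloSig}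

/-- A model of DLO with the K condition has the same order at every world. -/
theorem exists_isRigidDLO (hK : M.Kcond) (hT : M.SatTheory DLO.theory) :
    ∃ _ : LinearOrder M.D, M.IsRigidDLO := by
  classical
  let lt (w : M.W) (x y : M.D) : Prop := M.V w () (![x, y] : Fin 2 → M.D)
  have val_eq (w : M.W) (x : Fin 2 → M.D) : M.V w () x ↔ lt w (x 0) (x 1) := by
    have h : x = ![x 0, x 1] := by ext i; fin_cases i <;> rfl
    exact iff_of_eq (congrArg (M.V w ()) h)
  have truth_lt (w : M.W) (a : ℕ → M.D) (i j : ℕ) :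
      M.Truth w a (DLO.lt (DLO.v i) (DLO.v j)) ↔ lt w (a i) (a j) := val_eq w _
  obtain ⟨d₀⟩ := M.dne
  let a₀ : ℕ → M.D := fun _ => d₀
  have irrefl (w : M.W) (x : M.D) : ¬ lt w x x := fun h => by
    have := hT DLO.ax1 (by simp [DLO.theory]) a₀ x w w (M.base w)
    rw [truth_lt] at this
    exact this (by simpa using h)
  have trans (w : M.W) (x y z : M.D) (hxy : lt w x y) (hyz : lt w y z) : lt w x z := by
    have := hT DLO.ax3 (by simp [DLO.theory]) a₀ x y z w w (M.base w)
    rw [truth_lt] at this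
    simpa using this ⟨(truth_lt ..).2 (by simpa using hxy), (truth_lt ..).2 (by simpa using hyz)⟩
  have total (x y : M.D) : x = y ∨ lt M.s x y ∨ lt M.s y x := by
    rcases hT DLO.ax2 (by simp [DLO.theory]) a₀ x y with h | h | h
    · left; simpa [Truth, evalT, DLO.v] using h
    · right; left; simpa using (truth_lt ..).1 h
    · right; right; simpa using (truth_lt ..).1 h
  have rigid (w : M.W) (x y : M.D) : lt w x y ↔ lt M.s x y := by
    have mono (x y : M.D) : lt M.s x y → lt w x y := M.hered M.s w (hK.base_le w) () _
    refine ⟨fun h => ?_, mono x y⟩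
    rcases total x y with rfl | h' | h'
    · exact absurd h (irrefl w x)
    · exact h'
    · exact absurd (trans w x y x h (mono y x h')) (irrefl w x)
  have : IsStrictTotalOrder M.D (lt M.s) :=
    { irrefl := irrefl M.s
      trans := trans M.s
      trichotomous := fun x y hxy hyx => ((total x y).resolve_right (not_or.2 ⟨hxy, hyx⟩)) }
  refine ⟨linearOrderOfSTO (lt M.s), ?_⟩
  let := linearOrderOfSTO (lt M.s)
  refine ⟨fun w x => (val_eq w x).trans (rigid w _ _), ⟨fun x y hxy => ?_⟩,
    ⟨fun x => ?_⟩, ⟨fun x => ?_⟩⟩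
  · obtain ⟨z, hxz, hzy⟩ := hT DLO.ax4 (by simp [DLO.theory]) a₀ x y M.s M.s (M.base M.s)
      ((truth_lt ..).2 (by simpa using show lt M.s x y from hxy))
    rw [truth_lt] at hxz hzy
    exact ⟨z, show lt M.s x z by simpa using hxz, show lt M.s z y by simpa using hzy⟩
  · obtain ⟨y, h⟩ := hT DLO.ax6 (by simp [DLO.theory]) a₀ x
    rw [truth_lt] at h
    exact ⟨y, show lt M.s y x by simpa using h⟩
  · obtain ⟨y, h⟩ := hT DLO.ax5 (by simp [DLO.theory]) a₀ x
    rw [truth_lt] at h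
    exact ⟨y, show lt M.s x y by simpa using h⟩

end BModel

end RM

section BackAndForth

variable {α β : Type*} [LinearOrder α] [LinearOrder β]

/-- The assignments `a` and `b` order the variables in `S` in the same way. -/
def SameOrder (S : Finset ℕ) (a : ℕ → α) (b : ℕ → β) : Prop :=
  ∀ i ∈ S, ∀ j ∈ S, cmp (a i) (a j) = cmp (b i) (b j)

namespace SameOrder

variable {S : Finset ℕ} {a : ℕ → α} {b : ℕ → β}

theorem symm (h : SameOrder S a b) : SameOrder S b a :=
  fun i hi j hj => (h i hi j hj).symm

theorem eq_iff (h : SameOrder S a b) {i j : ℕ} (hi : i ∈ S) (hj : j ∈ S) :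
    a i = a j ↔ b i = b j := by
  rw [← cmp_eq_eq_iff (a i), ← cmp_eq_eq_iff (b i), h i hi j hj]

theorem lt_iff (h : SameOrder S a b) {i j : ℕ} (hi : i ∈ S) (hj : j ∈ S) :
    a i < a j ↔ b i < b j := by
  rw [← cmp_eq_lt_iff, ← cmp_eq_lt_iff, h i hi j hj]

theorem exists_update [DenselyOrdered β] [NoMinOrder β] [NoMaxOrder β] [Nonempty β]
    (h : SameOrder S a b) (x : ℕ) (d : α) :
    ∃ e : β, SameOrder (insert x S) (Function.update a x d) (Function.update b x e) := by
  classical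
  let f : Order.PartialIso α β := ⟨S.image fun i => (a i, b i), by
    simp only [Finset.mem_image]
    rintro _ ⟨i, hi, rfl⟩ _ ⟨j, hj, rfl⟩
    exact h i hi j hj⟩
  obtain ⟨e, he⟩ := Order.PartialIso.exists_across f d
  have he (i : ℕ) (hi : i ∈ S) : cmp (a i) d = cmp (b i) e :=
    he _ (Finset.mem_image_of_mem (fun i => (a i, b i)) hi)
  refine ⟨e, fun i hi j hj => ?_⟩
  rw [Finset.mem_insert] at hi hj
  by_cases hix : i = x <;> by_cases hjx : j = x
  · simp [hix, hjx]
  · have := he j (hj.resolve_left hjx)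
    rw [cmp_eq_cmp_symm] at this
    simpa [hix, hjx] using this
  · simpa [hix, hjx] using he i (hi.resolve_left hix)
  · simpa [hix, hjx] using h i (hi.resolve_left hix) j (hj.resolve_left hjx)

end SameOrder

end BackAndForth

namespace RM.BModel

variable {M N : BModel dloSig}

/-- Every term of the language of DLO is a variable. -/
theorem exists_evalT_eq (a : ℕ → M.D) (b : ℕ → N.D) (t : Term dloSig) {S : Set ℕ}
    (ht : t.fv ⊆ S) : ∃ i ∈ S, M.evalT a t = a i ∧ N.evalT b t = b i := by
  cases t with
  | var i => exact ⟨i, ht rfl, rfl, rfl⟩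
  | func f => exact Empty.elim f

/-- In serial models interpreting `<` rigidly by dense linear orders without endpoints,
truth does not depend on the world, and depends on the assignment only through
the order of the free variables. -/
theorem IsRigidDLO.truth_iff [LinearOrder M.D] [LinearOrder N.D]
    (hM : M.IsRigidDLO) (hN : N.IsRigidDLO) (hSM : M.Serial) (hSN : N.Serial)
    (A : Formula dloSig) {S : Finset ℕ} (hA : A.fv ⊆ S) {a : ℕ → M.D} {b : ℕ → N.D}
    (hab : SameOrder S a b) (w : M.W) (u : N.W) :
    M.Truth w a A ↔ N.Truth u b A := by
  have := hM.dense
  have := hM.noMin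
  have := hM.noMax
  have := hN.dense
  have := hN.noMin
  have := hN.noMax
  have := M.dne
  have := N.dne
  induction A generalizing S a b w u with
  | falsum => exact Iff.rfl
  | verum => exact Iff.rfl
  | equal t t' =>
    obtain ⟨i, hi, hai, hbi⟩ := exists_evalT_eq a b t (Set.subset_union_left.trans hA)
    obtain ⟨j, hj, haj, hbj⟩ := exists_evalT_eq a b t' (Set.subset_union_right.trans hA)
    simp only [Truth, hai, haj, hbi, hbj]
    exact hab.eq_iff hi hj
  | rel r ts =>
    obtain ⟨i, hi, hai, hbi⟩ := exists_evalT_eq a b (ts (0 : Fin 2))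
      ((Set.subset_iUnion (fun k => (ts k).fv) (0 : Fin 2)).trans hA)
    obtain ⟨j, hj, haj, hbj⟩ := exists_evalT_eq a b (ts (1 : Fin 2))
      ((Set.subset_iUnion (fun k => (ts k).fv) (1 : Fin 2)).trans hA)
    refine (hM.val_iff w _).trans (Iff.trans ?_ (hN.val_iff u _).symm)
    rw [hai, haj, hbi, hbj]
    exact hab.lt_iff hi hj
  | and A B ihA ihB =>
    obtain ⟨hA, hB⟩ := Set.union_subset_iff.1 hA
    exact and_congr (ihA hA hab w u) (ihB hB hab w u)
  | or A B ihA ihB =>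
    obtain ⟨hA, hB⟩ := Set.union_subset_iff.1 hA
    exact or_congr (ihA hA hab w u) (ihB hB hab w u)
  | neg A ih => exact not_congr (ih hA hab _ _)
  | imp A B ihA ihB =>
    obtain ⟨hA, hB⟩ := Set.union_subset_iff.1 hA
    constructor
    · intro h u₁ u₂ _ hu
      obtain ⟨w₁, w₂, hw⟩ := hSM w
      exact (ihB hB hab w₂ u₂).1 (h w₁ w₂ hw ((ihA hA hab w₁ u₁).2 hu))
    · intro h w₁ w₂ _ hw
      obtain ⟨u₁, u₂, hu⟩ := hSN u
      exact (ihB hB hab w₂ u₂).2 (h u₁ u₂ hu ((ihA hA hab w₁ u₁).1 hw))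
  | all x A ih =>
    have hA : A.fv ⊆ (insert x S : Finset ℕ) := by
      rw [Finset.coe_insert]
      exact Set.sdiff_singleton_subset_iff.1 hA
    constructor
    · intro h e
      obtain ⟨d, hd⟩ := hab.symm.exists_update x e
      exact (ih hA hd.symm w u).1 (h d)
    · intro h d
      obtain ⟨e, he⟩ := hab.exists_update x d
      exact (ih hA he w u).2 (h e)
  | ex x A ih =>
    have hA : A.fv ⊆ (insert x S : Finset ℕ) := by
      rw [Finset.coe_insert]
      exact Set.sdiff_singleton_subset_iff.1 hA
    constructor
    · rintro ⟨d, h⟩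
      obtain ⟨e, he⟩ := hab.exists_update x d
      exact ⟨e, (ih hA he w u).1 h⟩
    · rintro ⟨e, h⟩
      obtain ⟨d, hd⟩ := hab.symm.exists_update x e
      exact ⟨d, (ih hA hd.symm w u).2 h⟩

end RM.BModel

/-- **Completeness of DLO over B + K with seriality**: any two such models of
DLO satisfy exactly the same sentences at their designated worlds. -/
theorem stmt_14 (M N : BModel dloSig)
    (hKM : M.Kcond) (hSM : M.Serial) (hKN : N.Kcond) (hSN : N.Serial)
    (hTM : M.SatTheory DLO.theory) (hTN : N.SatTheory DLO.theory)
    (A : Formula dloSig) (hA : A.Sentence) :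
    M.SatAx A ↔ N.SatAx A := by
  obtain ⟨_, hM⟩ := BModel.exists_isRigidDLO hKM hTM
  obtain ⟨_, hN⟩ := BModel.exists_isRigidDLO hKN hTN
  have key (a : ℕ → M.D) (b : ℕ → N.D) : M.Truth M.s a A ↔ N.Truth N.s b A :=
    hM.truth_iff hN hSM hSN A (S := ∅) (by rw [hA]; exact Set.empty_subset _)
      (fun i hi => absurd hi (Finset.notMem_empty i)) M.s N.s
  obtain ⟨d⟩ := M.dne
  obtain ⟨e⟩ := N.dne
  exact ⟨fun h b => (key (fun _ => d) b).1 (h _), fun h a => (key a (fun _ => e)).2 (h _)⟩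
end
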